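/- The rewrite system x' of PTSCα is terminating: every term and every list of PTSCα (possibly containing meta-variables) is strongly normalising for the contextual closure →_{x'} of the rules of system x'. -/

import Mathlib

set_option maxHeartbeats 1000000
set_option linter.unreachableTactic false
set_option linter.unusedTactic false

/- ### Syntax of PTSCα -/

mutual
inductive Trm (S : Type) : Type
  | pi    : ℕ → Trm S → Trm S → Trm S            -- Πx:A.B
  | lam   : ℕ → Trm S → Trm S → Trm S            -- λx:A.M
  | sort  : S → Trm S
  | appv  : ℕ → Lst S → Trm S                     -- x l
  | app   : Trm S → Lst S → Trm S                 -- M l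
  | esub  : Trm S → Trm S → ℕ → Trm S → Trm S    -- ⟨A, M/x⟩N
  | mvarT : ℕ → Args S → Trm S                    -- α(M₁,…,Mₙ)

inductive Lst (S : Type) : Type
  | nil   : Lst S
  | cons  : Trm S → Lst S → Lst S
  | conc  : Lst S → Lst S → Lst S
  | esub  : Trm S → Trm S → ℕ → Lst S → Lst S
  | mvarL : ℕ → Args S → Lst S

inductive Args (S : Type) : Type
  | nil   : Args S
  | cons  : Trm S → Args S → Args S
end

/- Free variables -/
mutual
def fvT {S : Type} : Trm S → Finset ℕ
  | .pi x A B => fvT A ∪ (fvT B).erase x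
  | .lam x A M => fvT A ∪ (fvT M).erase x
  | .sort _ => ∅
  | .appv x l => insert x (fvL l)
  | .app M l => fvT M ∪ fvL l
  | .esub A P x N => fvT A ∪ fvT P ∪ (fvT N).erase x
  | .mvarT _ args => fvA args
def fvL {S : Type} : Lst S → Finset ℕ
  | .nil => ∅
  | .cons M l => fvT M ∪ fvL l
  | .conc l l' => fvL l ∪ fvL l'
  | .esub A P x l => fvT A ∪ fvT P ∪ (fvL l).erase x
  | .mvarL _ args => fvA args
def fvA {S : Type} : Args S → Finset ℕ
  | .nil => ∅
  | .cons M as => fvT M ∪ fvA as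
end

/-- mapping an explicit substitution over the arguments of a meta-variable -/
def subArgs {S : Type} (A P : Trm S) (y : ℕ) : Args S → Args S
  | .nil => .nil
  | .cons M as => .cons (.esub A P y M) (subArgs A P y as)

/-- length of a sequence of meta-variable arguments -/
def argsLen {S : Type} : Args S → ℕ
  | .nil => 0
  | .cons _ as => argsLen as + 1

/- ### Reduction: root steps.
   `bB` tells whether rule B is included, `bX` whether system x' is included. -/

inductive TopT (S : Type) (bB bX : Bool) : Trm S → Trm S → Prop
  | beta {x : ℕ} {A M N : Trm S} {l : Lst S} :
      bB = true → TopT S bB bX (.app (.lam x A M) (.cons N l)) (.app (.esub A N x M) l)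
  | b1 {M : Trm S} : bX = true → TopT S bB bX (.app M .nil) M
  | b2 {x : ℕ} {l l' : Lst S} :
      bX = true → TopT S bB bX (.app (.appv x l) l') (.appv x (.conc l l'))
  | b3 {M : Trm S} {l l' : Lst S} :
      bX = true → TopT S bB bX (.app (.app M l) l') (.app M (.conc l l'))
  | c1 {G P A M : Trm S} {x y : ℕ} :
      bX = true → x ≠ y → x ∉ fvT P →
      TopT S bB bX (.esub G P y (.lam x A M)) (.lam x (.esub G P y A) (.esub G P y M))
  | c2 {G P : Trm S} {y : ℕ} {l : Lst S} :
      bX = true → TopT S bB bX (.esub G P y (.appv y l)) (.app P (.esub G P y l))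
  | c3 {G P : Trm S} {x y : ℕ} {l : Lst S} :
      bX = true → x ≠ y → TopT S bB bX (.esub G P y (.appv x l)) (.appv x (.esub G P y l))
  | c4 {G P M : Trm S} {y : ℕ} {l : Lst S} :
      bX = true → TopT S bB bX (.esub G P y (.app M l)) (.app (.esub G P y M) (.esub G P y l))
  | c5 {G P A B : Trm S} {x y : ℕ} :
      bX = true → x ≠ y → x ∉ fvT P →
      TopT S bB bX (.esub G P y (.pi x A B)) (.pi x (.esub G P y A) (.esub G P y B))
  | c6 {G P : Trm S} {y : ℕ} {s : S} :
      bX = true → TopT S bB bX (.esub G P y (.sort s)) (.sort s)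
  | calpha {A P : Trm S} {y a : ℕ} {args : Args S} :
      bX = true → TopT S bB bX (.esub A P y (.mvarT a args)) (.mvarT a (subArgs A P y args))

inductive TopL (S : Type) (bB bX : Bool) : Lst S → Lst S → Prop
  | a1 {M : Trm S} {l l' : Lst S} :
      bX = true → TopL S bB bX (.conc (.cons M l') l) (.cons M (.conc l' l))
  | a2 {l : Lst S} : bX = true → TopL S bB bX (.conc .nil l) l
  | a3 {l l' l'' : Lst S} :
      bX = true → TopL S bB bX (.conc (.conc l l') l'') (.conc l (.conc l' l''))
  | a4 {l : Lst S} : bX = true → TopL S bB bX (.conc l .nil) l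
  | d1 {G P : Trm S} {y : ℕ} : bX = true → TopL S bB bX (.esub G P y .nil) .nil
  | d2 {G P M : Trm S} {y : ℕ} {l : Lst S} :
      bX = true → TopL S bB bX (.esub G P y (.cons M l)) (.cons (.esub G P y M) (.esub G P y l))
  | d3 {G P : Trm S} {y : ℕ} {l l' : Lst S} :
      bX = true → TopL S bB bX (.esub G P y (.conc l l')) (.conc (.esub G P y l) (.esub G P y l'))
  | dbeta {A P : Trm S} {y b : ℕ} {args : Args S} :
      bX = true → TopL S bB bX (.esub A P y (.mvarL b args)) (.mvarL b (subArgs A P y args))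

/- ### Contextual closure -/

mutual
inductive RedT (S : Type) (bB bX : Bool) : Trm S → Trm S → Prop
  | top {M N : Trm S} : TopT S bB bX M N → RedT S bB bX M N
  | pi1 {x : ℕ} {A A' B : Trm S} : RedT S bB bX A A' → RedT S bB bX (.pi x A B) (.pi x A' B)
  | pi2 {x : ℕ} {A B B' : Trm S} : RedT S bB bX B B' → RedT S bB bX (.pi x A B) (.pi x A B')
  | lam1 {x : ℕ} {A A' M : Trm S} : RedT S bB bX A A' → RedT S bB bX (.lam x A M) (.lam x A' M)
  | lam2 {x : ℕ} {A M M' : Trm S} : RedT S bB bX M M' → RedT S bB bX (.lam x A M) (.lam x A M')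
  | appv1 {x : ℕ} {l l' : Lst S} : RedL S bB bX l l' → RedT S bB bX (.appv x l) (.appv x l')
  | app1 {M M' : Trm S} {l : Lst S} : RedT S bB bX M M' → RedT S bB bX (.app M l) (.app M' l)
  | app2 {M : Trm S} {l l' : Lst S} : RedL S bB bX l l' → RedT S bB bX (.app M l) (.app M l')
  | esub1 {A A' P N : Trm S} {x : ℕ} :
      RedT S bB bX A A' → RedT S bB bX (.esub A P x N) (.esub A' P x N)
  | esub2 {A P P' N : Trm S} {x : ℕ} :
      RedT S bB bX P P' → RedT S bB bX (.esub A P x N) (.esub A P' x N)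
  | esub3 {A P N N' : Trm S} {x : ℕ} :
      RedT S bB bX N N' → RedT S bB bX (.esub A P x N) (.esub A P x N')
  | mvar1 {a : ℕ} {args args' : Args S} :
      RedA S bB bX args args' → RedT S bB bX (.mvarT a args) (.mvarT a args')

inductive RedL (S : Type) (bB bX : Bool) : Lst S → Lst S → Prop
  | top {l l' : Lst S} : TopL S bB bX l l' → RedL S bB bX l l'
  | cons1 {M M' : Trm S} {l : Lst S} : RedT S bB bX M M' → RedL S bB bX (.cons M l) (.cons M' l)
  | cons2 {M : Trm S} {l l' : Lst S} : RedL S bB bX l l' → RedL S bB bX (.cons M l) (.cons M l')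
  | conc1 {l l' m : Lst S} : RedL S bB bX l l' → RedL S bB bX (.conc l m) (.conc l' m)
  | conc2 {l m m' : Lst S} : RedL S bB bX m m' → RedL S bB bX (.conc l m) (.conc l m')
  | esub1 {A A' P : Trm S} {x : ℕ} {l : Lst S} :
      RedT S bB bX A A' → RedL S bB bX (.esub A P x l) (.esub A' P x l)
  | esub2 {A P P' : Trm S} {x : ℕ} {l : Lst S} :
      RedT S bB bX P P' → RedL S bB bX (.esub A P x l) (.esub A P' x l)
  | esub3 {A P : Trm S} {x : ℕ} {l l' : Lst S} :
      RedL S bB bX l l' → RedL S bB bX (.esub A P x l) (.esub A P x l')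
  | mvar1 {b : ℕ} {args args' : Args S} :
      RedA S bB bX args args' → RedL S bB bX (.mvarL b args) (.mvarL b args')

inductive RedA (S : Type) (bB bX : Bool) : Args S → Args S → Prop
  | hd {M M' : Trm S} {as : Args S} : RedT S bB bX M M' → RedA S bB bX (.cons M as) (.cons M' as)
  | tl {M : Trm S} {as as' : Args S} : RedA S bB bX as as' → RedA S bB bX (.cons M as) (.cons M as')
end

/-- one-step reduction by system x' alone, on terms -/
abbrev RedXT (S : Type) : Trm S → Trm S → Prop := RedT S false true
/-- one-step reduction by system x' alone, on lists -/
abbrev RedXL (S : Type) : Lst S → Lst S → Prop := RedL S false true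
/-- one-step reduction by rule B alone, on terms -/
abbrev RedBT (S : Type) : Trm S → Trm S → Prop := RedT S true false
/-- one-step reduction by rule B alone, on lists -/
abbrev RedBL (S : Type) : Lst S → Lst S → Prop := RedL S true false
/-- one-step reduction by B together with x', on terms -/
abbrev RedBXT (S : Type) : Trm S → Trm S → Prop := RedT S true true
/-- one-step reduction by B together with x', on lists -/
abbrev RedBXL (S : Type) : Lst S → Lst S → Prop := RedL S true true

/- A polynomial interpretation of terms, lists and argument sequences in `ℕ`
under which every step of system x' is strictly decreasing. -/
mutual
def weightT {S : Type} : Trm S → ℕ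
  | .pi _ A B => weightT A + weightT B + 1
  | .lam _ A M => weightT A + weightT M + 1
  | .sort _ => 1
  | .appv _ l => weightL l + 2
  | .app M l => 2 * weightT M + weightL l + 1
  | .esub A P _ N => (weightT A + weightT P + 2) * weightT N
  | .mvarT _ args => weightA args + 1
def weightL {S : Type} : Lst S → ℕ
  | .nil => 1
  | .cons M l => weightT M + weightL l + 1
  | .conc l l' => 2 * weightL l + weightL l' + 1
  | .esub A P _ l => (weightT A + weightT P + 2) * weightL l
  | .mvarL _ args => weightA args + 1
def weightA {S : Type} : Args S → ℕ
  | .nil => 0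
  | .cons M as => weightT M + weightA as
end

mutual
theorem weightT_pos {S : Type} : ∀ M : Trm S, 0 < weightT M
  | .pi _ _ _ | .lam _ _ _ | .sort _ | .appv _ _ | .app _ _ | .mvarT _ _ => by simp [weightT]
  | .esub _ _ _ N => by
      have := weightT_pos N
      simp only [weightT]
      positivity
theorem weightL_pos {S : Type} : ∀ l : Lst S, 0 < weightL l
  | .nil | .cons _ _ | .conc _ _ | .mvarL _ _ => by simp [weightL]
  | .esub _ _ _ l => by
      have := weightL_pos l
      simp only [weightL]
      positivity
end

theorem weightA_subArgs {S : Type} (A P : Trm S) (y : ℕ) :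
    ∀ as : Args S, weightA (subArgs A P y as) = (weightT A + weightT P + 2) * weightA as
  | .nil => by simp [subArgs, weightA]
  | .cons M as => by simp only [subArgs, weightA, weightT, weightA_subArgs A P y as, mul_add]

theorem TopT.weightT_lt {S : Type} {M N : Trm S} (h : TopT S false true M N) :
    weightT N < weightT M := by
  cases h <;> simp_all only [weightT, weightL, weightA_subArgs, Bool.false_eq_true] <;> nlinarith

theorem TopL.weightL_lt {S : Type} {l l' : Lst S} (h : TopL S false true l l') :
    weightL l' < weightL l := by
  cases h <;> simp only [weightT, weightL, weightA_subArgs] <;> nlinarith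

mutual
theorem RedT.weightT_lt {S : Type} {M N : Trm S} : RedT S false true M N → weightT N < weightT M
  | .top h => h.weightT_lt
  | .pi1 h | .pi2 h | .lam1 h | .lam2 h | .app1 h => by
      have := h.weightT_lt
      simp only [weightT]
      omega
  | .appv1 h | .app2 h => by
      have := h.weightL_lt
      simp only [weightT]
      omega
  | .esub1 (N := N) h | .esub2 (N := N) h => by
      have := h.weightT_lt
      simp only [weightT]
      exact Nat.mul_lt_mul_of_pos_right (by omega) (weightT_pos N)
  | .esub3 h => by
      have := h.weightT_lt
      simp only [weightT]
      exact Nat.mul_lt_mul_of_pos_left this (by omega)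
  | .mvar1 h => by
      have := h.weightA_lt
      simp only [weightT]
      omega
theorem RedL.weightL_lt {S : Type} {l l' : Lst S} : RedL S false true l l' → weightL l' < weightL l
  | .top h => h.weightL_lt
  | .cons1 h => by
      have := h.weightT_lt
      simp only [weightL]
      omega
  | .cons2 h | .conc1 h | .conc2 h => by
      have := h.weightL_lt
      simp only [weightL]
      omega
  | .esub1 (l := l) h | .esub2 (l := l) h => by
      have := h.weightT_lt
      simp only [weightL]
      exact Nat.mul_lt_mul_of_pos_right (by omega) (weightL_pos l)
  | .esub3 h => by
      have := h.weightL_lt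
      simp only [weightL]
      exact Nat.mul_lt_mul_of_pos_left this (by omega)
  | .mvar1 h => by
      have := h.weightA_lt
      simp only [weightL]
      omega
theorem RedA.weightA_lt {S : Type} {as as' : Args S} :
    RedA S false true as as' → weightA as' < weightA as
  | .hd h => by
      have := h.weightT_lt
      simp only [weightA]
      omega
  | .tl h => by
      have := h.weightA_lt
      simp only [weightA]
      omega
end

/-- System x' is terminating: every term and every list of PTSCα
(possibly containing meta-variables) is strongly normalising for `→_{x'}`. -/
theorem x'_terminating (S : Type) :
    (∀ M : Trm S, Acc (fun N M => RedXT S M N) M) ∧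
    (∀ l : Lst S, Acc (fun l' l => RedXL S l l') l) :=
  ⟨fun M => (Subrelation.wf (fun h => RedT.weightT_lt h) (measure weightT).wf).apply M,
   fun l => (Subrelation.wf (fun h => RedL.weightL_lt h) (measure weightL).wf).apply l⟩
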